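/- Let G be a countable group acting faithfully on the right by homeomorphisms on a second countable Hausdorff topological space X, and let μ be an ergodic invariant random subgroup of G that is not the Dirac mass at the trivial subgroup {1}. Then for μ-almost every subgroup H ≤ G there exists a nonempty open set U ⊆ X such that [R_G(U), R_G(U)] ≤ H. -/

import Mathlib

open MulOpposite MeasureTheory

/-- The σ-algebra on the space of subgroups of `G`, generated by the sets
`{H : g ∈ H}` for `g ∈ G` (the Borel σ-algebra of the Chabauty topology). -/
instance subgroupMeasurableSpace (G : Type*) [Group G] : MeasurableSpace (Subgroup G) :=
  MeasurableSpace.generateFrom {A : Set (Subgroup G) | ∃ g : G, A = {H : Subgroup G | g ∈ H}}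

/-- Conjugation `H ↦ g⁻¹ H g` on subgroups. -/
def conjSubgroup {G : Type*} [Group G] (g : G) (H : Subgroup G) : Subgroup G :=
  Subgroup.map (MulAut.conj g⁻¹).toMonoidHom H

/-- Pointwise stabilizer of a set `A ⊆ X` for a right action of `G` on `X`:
`{g ∈ G : x·g = x for all x ∈ A}`. -/
def pointwiseStabilizer (G : Type*) {X : Type*} [Group G] [MulAction Gᵐᵒᵖ X] (A : Set X) :
    Subgroup G where
  carrier := {g : G | ∀ x ∈ A, op g • x = x}
  one_mem' := by intro x _; simp
  mul_mem' := by
    intro g h hg hh x hx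
    have h1 : op (g * h) • x = op h • (op g • x) := by
      rw [op_mul, mul_smul]
    rw [h1, hg x hx, hh x hx]
  inv_mem' := by
    intro g hg x hx
    have h1 : op g⁻¹ • (op g • x) = x := by
      rw [op_inv]; exact inv_smul_smul _ _
    rw [hg x hx] at h1
    exact h1

/-- Rigid stabilizer `R_G(U) = {g ∈ G : x·g = x for all x ∈ X \ U}`. -/
def rigidStabilizer (G : Type*) {X : Type*} [Group G] [MulAction Gᵐᵒᵖ X] (U : Set X) :
    Subgroup G :=
  pointwiseStabilizer G Uᶜ

/-- The fixed-point set of a subgroup `H` in `X`: `Fix(H) = {x : x·h = x for all h ∈ H}`. -/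
def fixedSet (X : Type*) {G : Type*} [Group G] [MulAction Gᵐᵒᵖ X] (H : Subgroup G) : Set X :=
  {x : X | ∀ h ∈ H, op h • x = x}

section Helpers

open scoped commutatorElement

variable {G : Type*} [Group G]

lemma mem_conjSubgroup' (g x : G) (H : Subgroup G) :
    x ∈ conjSubgroup g H ↔ g * x * g⁻¹ ∈ H := by
  unfold conjSubgroup
  rw [Subgroup.mem_map]
  constructor
  · rintro ⟨y, hy, rfl⟩
    simpa [mul_assoc] using hy
  · intro h
    exact ⟨_, h, by simp [mul_assoc]⟩

lemma measurableSet_memSub (g : G) : MeasurableSet {H : Subgroup G | g ∈ H} :=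
  MeasurableSpace.measurableSet_generateFrom ⟨g, rfl⟩

/-- `c` is a quotient of two elements `γ` of `Γ` with `γ⁻¹ g γ ∈ H`. -/
def TRel (Γ : Subgroup G) (g : G) (H : Subgroup G) (c : G) : Prop :=
  ∃ δ : Γ, (δ : G)⁻¹ * g * δ ∈ H ∧ (c * δ)⁻¹ * g * (c * δ) ∈ H

lemma TRel_conj (Γ : Subgroup G) (g : G) (H : Subgroup G) (c : G) (η : Γ) :
    TRel Γ g (conjSubgroup (η : G) H) c ↔ TRel Γ g H c := by
  unfold TRel
  constructor
  · rintro ⟨δ, h1, h2⟩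
    rw [mem_conjSubgroup'] at h1 h2
    refine ⟨δ * η⁻¹, ?_, ?_⟩
    · simpa [mul_assoc] using h1
    · simpa [mul_assoc] using h2
  · rintro ⟨δ, h1, h2⟩
    refine ⟨δ * η, ?_, ?_⟩
    · rw [mem_conjSubgroup']
      simpa [mul_assoc] using h1
    · rw [mem_conjSubgroup']
      simpa [mul_assoc] using h2

lemma measurableSet_TRel [Countable G] (Γ : Subgroup G) (g c : G) :
    MeasurableSet {H : Subgroup G | TRel Γ g H c} := by
  have : {H : Subgroup G | TRel Γ g H c} = ⋃ δ : Γ,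
      ({H : Subgroup G | (δ : G)⁻¹ * g * δ ∈ H} ∩
        {H : Subgroup G | (c * δ)⁻¹ * g * (c * δ) ∈ H}) := by
    ext H
    simp [TRel]
  rw [this]
  exact MeasurableSet.iUnion fun δ => (measurableSet_memSub _).inter (measurableSet_memSub _)

/-- tuples in pairwise distinct classes -/
def ZSet (Γ : Subgroup G) (g : G) {N : ℕ} (t : Fin N → Γ) : Set (Subgroup G) :=
  {H | ∀ i j, i ≠ j → ¬ TRel Γ g H ((t i : G) * (t j : G)⁻¹)}

lemma measurableSet_ZSet [Countable G] (Γ : Subgroup G) (g : G) {N : ℕ} (t : Fin N → Γ) :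
    MeasurableSet (ZSet Γ g t) := by
  have : ZSet Γ g t = ⋂ i, ⋂ j, ⋂ (_ : i ≠ j),
      {H : Subgroup G | TRel Γ g H ((t i : G) * (t j : G)⁻¹)}ᶜ := by
    ext H
    simp [ZSet]
  rw [this]
  exact MeasurableSet.iInter fun i => MeasurableSet.iInter fun j => MeasurableSet.iInter fun _ =>
    (measurableSet_TRel _ _ _).compl

lemma ZSet_conj (Γ : Subgroup G) (g : G) {N : ℕ} (t : Fin N → Γ) (H : Subgroup G) (η : Γ) :
    conjSubgroup (η : G) H ∈ ZSet Γ g t ↔ H ∈ ZSet Γ g t := by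
  simp only [ZSet, Set.mem_ofPred_eq, TRel_conj]

lemma ZSet_bound [Countable G] (μ : Measure (Subgroup G))
    (hinv : ∀ g : G, ∀ A : Set (Subgroup G), MeasurableSet A →
      μ ((fun H : Subgroup G => conjSubgroup g H) ⁻¹' A) = μ A)
    (Γ : Subgroup G) (g : G) {N : ℕ} (t : Fin N → Γ) (W : Set (Subgroup G))
    (hW : MeasurableSet W) (hWZ : W ⊆ ZSet Γ g t)
    (hWc : ∀ (η : Γ) H, conjSubgroup (η : G) H ∈ W ↔ H ∈ W) :
    N * μ (W ∩ {H | g ∈ H}) ≤ μ W := by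
  have key : ∀ i : Fin N, μ (W ∩ {H | (t i : G)⁻¹ * g * (t i : G) ∈ H}) = μ (W ∩ {H | g ∈ H}) := by
    intro i
    rw [← hinv ((t i : G)⁻¹) (W ∩ {H | g ∈ H}) (hW.inter (measurableSet_memSub _))]
    congr 1
    ext H
    have := hWc ((t i)⁻¹) H
    simp only [Subgroup.coe_inv] at this
    simp only [Set.mem_inter_iff, Set.mem_preimage, Set.mem_ofPred_eq, this, mem_conjSubgroup',
      inv_inv]
  calc (N : ENNReal) * μ (W ∩ {H | g ∈ H})
      = ∑ i : Fin N, μ (W ∩ {H | (t i : G)⁻¹ * g * (t i : G) ∈ H}) := by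
        simp [key]
    _ = μ (⋃ i, W ∩ {H | (t i : G)⁻¹ * g * (t i : G) ∈ H}) := by
        rw [measure_iUnion, tsum_fintype]
        · intro i j hij
          rw [Function.onFun, Set.disjoint_left]
          rintro H ⟨hHW, hi⟩ ⟨-, hj⟩
          refine hWZ hHW i j hij ⟨t j, hj, ?_⟩
          simpa [mul_assoc] using hi
        · exact fun i => hW.inter (measurableSet_memSub _)
    _ ≤ μ W := measure_mono (Set.iUnion_subset fun i => Set.inter_subset_left)

lemma lemmaA [Countable G] (μ : Measure (Subgroup G)) [IsProbabilityMeasure μ]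
    (hinv : ∀ g : G, ∀ A : Set (Subgroup G), MeasurableSet A →
      μ ((fun H : Subgroup G => conjSubgroup g H) ⁻¹' A) = μ A)
    (Γ : Subgroup G) (g : G) :
    ∀ᵐ H ∂μ, g ∈ H → ∃ N : ℕ, ∀ t : Fin N → Γ, ∃ i j, i ≠ j ∧
      TRel Γ g H ((t i : G) * (t j : G)⁻¹) := by
  rw [ae_iff]
  set B := {H : Subgroup G | ¬ (g ∈ H → ∃ N : ℕ, ∀ t : Fin N → Γ, ∃ i j, i ≠ j ∧
      TRel Γ g H ((t i : G) * (t j : G)⁻¹))} with hB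
  have bound : ∀ N : ℕ, N * μ B ≤ 1 := by
    intro N
    obtain ⟨f, hf⟩ := exists_surjective_nat (Fin N → Γ)
    let W : ℕ → Set (Subgroup G) := fun n =>
      {H | H ∈ ZSet Γ g (f n) ∧ ∀ m, m < n → H ∉ ZSet Γ g (f m)}
    have hWm : ∀ n, MeasurableSet (W n) := by
      intro n
      have : W n = ZSet Γ g (f n) ∩ ⋂ m, ⋂ (_ : m < n), (ZSet Γ g (f m))ᶜ := by
        ext H
        simp [W]
      rw [this]
      exact (measurableSet_ZSet _ _ _).inter (MeasurableSet.iInter fun m =>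
        MeasurableSet.iInter fun _ => (measurableSet_ZSet _ _ _).compl)
    have hWd : Pairwise (Function.onFun Disjoint W) := by
      intro m n hmn
      rw [Function.onFun, Set.disjoint_left]
      rintro H ⟨h1, h2⟩ ⟨h3, h4⟩
      rcases lt_or_gt_of_ne hmn with h | h
      · exact h4 _ h h1
      · exact h2 _ h h3
    have hsub : B ⊆ ⋃ n, W n ∩ {H | g ∈ H} := by
      intro H hH
      simp only [hB, Set.mem_ofPred_eq] at hH
      push Not at hH
      obtain ⟨hg, hN⟩ := hH
      obtain ⟨t, ht⟩ := hN N
      have hex : ∃ n, H ∈ ZSet Γ g (f n) := by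
        obtain ⟨n, hn⟩ := hf t
        exact ⟨n, by rw [hn]; exact ht⟩
      classical
      exact Set.mem_iUnion.2 ⟨Nat.find hex, ⟨Nat.find_spec hex, fun m hm => Nat.find_min hex hm⟩, hg⟩
    calc (N : ENNReal) * μ B ≤ N * ∑' n, μ (W n ∩ {H | g ∈ H}) := by
          gcongr
          exact (measure_mono hsub).trans (measure_iUnion_le _)
      _ = ∑' n, N * μ (W n ∩ {H | g ∈ H}) := ENNReal.tsum_mul_left.symm
      _ ≤ ∑' n, μ (W n) := by
          refine ENNReal.tsum_le_tsum fun n => ?_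
          refine ZSet_bound μ hinv Γ g (f n) (W n) (hWm n) (fun H h => h.1) ?_
          intro η H
          simp only [W, Set.mem_ofPred_eq, ZSet_conj]
      _ = μ (⋃ n, W n) := (measure_iUnion hWd hWm).symm
      _ ≤ 1 := prob_le_one
  by_contra h0
  obtain ⟨n, hn⟩ := ENNReal.exists_nat_mul_gt h0 ENNReal.one_ne_top
  exact absurd (bound n) (not_le.2 hn)

lemma finite_image (Γ : Subgroup G) (g : G) (H P : Subgroup G)
    (hP : ∀ c, c ∈ Γ → TRel Γ g H c → c ∈ P)
    (hN : ∃ N : ℕ, ∀ t : Fin N → Γ, ∃ i j, i ≠ j ∧ TRel Γ g H ((t i : G) * (t j : G)⁻¹)) :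
    ((fun x : G => (x : G ⧸ P)) '' (Γ : Set G)).Finite := by
  obtain ⟨N, hN⟩ := hN
  by_contra hinf
  obtain ⟨s, hs, hcard⟩ := Set.Infinite.exists_subset_card_eq hinf N
  have e : Fin N ≃ s := (s.equivFinOfCardEq hcard).symm
  have hch : ∀ i : Fin N, ∃ x : Γ, ((x : G) : G ⧸ P) = (e i : G ⧸ P) := by
    intro i
    obtain ⟨x, hx, hxe⟩ := hs (e i).2
    exact ⟨⟨x, hx⟩, hxe⟩
  choose t ht using hch
  obtain ⟨i, j, hij, h⟩ := hN (fun i => (t i)⁻¹)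
  apply hij
  apply e.injective
  apply Subtype.ext
  rw [← ht i, ← ht j, QuotientGroup.eq]
  have := hP _ (Γ.mul_mem ((t i)⁻¹).2 (Γ.inv_mem ((t j)⁻¹).2)) h
  simpa using this

variable {X : Type*} [MulAction Gᵐᵒᵖ X]

lemma mem_rigid {U : Set X} {g : G} :
    g ∈ rigidStabilizer G U ↔ ∀ x, x ∉ U → op g • x = x := Iff.rfl

lemma rigid_mono {U V : Set X} (h : U ⊆ V) : rigidStabilizer G U ≤ rigidStabilizer G V :=
  fun _ hg x hx => hg x (fun hU => hx (h hU))

lemma rigid_maps {U : Set X} {g : G} (hg : g ∈ rigidStabilizer G U) {x : X} (hx : x ∈ U) :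
    op g • x ∈ U := by
  by_contra h
  have h1 := hg _ h
  have h2 : op g • x = x := MulAction.injective (op g) h1
  rw [h2] at h
  exact h hx

lemma rigid_commute (hfaith : ∀ g : G, (∀ x : X, op g • x = x) → g = 1) {U V : Set X}
    (hUV : Disjoint U V) {a b : G}
    (ha : a ∈ rigidStabilizer G U) (hb : b ∈ rigidStabilizer G V) : a * b = b * a := by
  have key : ∀ x : X, op (a * b) • x = op (b * a) • x := by
    intro x
    rw [op_mul, op_mul, mul_smul, mul_smul]
    by_cases hxU : x ∈ U
    · rw [hb x (Set.disjoint_left.1 hUV hxU),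
        hb _ (Set.disjoint_left.1 hUV (rigid_maps ha hxU))]
    · rw [ha x hxU]
      by_cases hxV : x ∈ V
      · rw [ha _ (Set.disjoint_right.1 hUV (rigid_maps hb hxV))]
      · rw [hb x hxV, ha x hxU]
  have := hfaith ((a * b) * (b * a)⁻¹) (fun x => by
    rw [op_mul, mul_smul, key, op_inv, inv_smul_smul])
  exact mul_inv_eq_one.1 this

lemma rigid_eq_one (hfaith : ∀ g : G, (∀ x : X, op g • x = x) → g = 1) {U V : Set X}
    (hUV : Disjoint U V) {a : G}
    (ha : a ∈ rigidStabilizer G U) (hb : a ∈ rigidStabilizer G V) : a = 1 := by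
  apply hfaith
  intro x
  by_cases hxU : x ∈ U
  · exact hb x (Set.disjoint_left.1 hUV hxU)
  · exact ha x hxU

lemma rigid_conj {U : Set X} {a g : G} (ha : a ∈ rigidStabilizer G U) :
    g⁻¹ * a * g ∈ rigidStabilizer G ((fun x => op g • x) '' U) := by
  intro x hx
  rw [op_mul, op_mul, mul_smul, mul_smul]
  have : op g⁻¹ • x ∉ U := fun h => hx ⟨_, h, by simp⟩
  rw [ha _ this]
  simp

/-- projection to `R(U)` of `H ∩ (R(W) R(U))` -/
def projSub (hfaith : ∀ g : G, (∀ x : X, op g • x = x) → g = 1) (H : Subgroup G) (U W : Set X)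
    (hUW : Disjoint U W) : Subgroup G where
  carrier := {a | a ∈ rigidStabilizer G U ∧ ∃ b ∈ rigidStabilizer G W, b * a ∈ H}
  one_mem' := ⟨one_mem _, 1, one_mem _, by simp [one_mem]⟩
  mul_mem' := by
    rintro a a' ⟨ha, b, hb, h⟩ ⟨ha', b', hb', h'⟩
    refine ⟨mul_mem ha ha', b * b', mul_mem hb hb', ?_⟩
    have := mul_mem h h'
    have hc := rigid_commute hfaith hUW ha hb'
    have e : b * a * (b' * a') = b * b' * (a * a') := by
      calc b * a * (b' * a') = b * (a * b') * a' := by group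
        _ = b * b' * (a * a') := by rw [hc]; group
    rwa [e] at this
  inv_mem' := by
    rintro a ⟨ha, b, hb, h⟩
    refine ⟨inv_mem ha, b⁻¹, inv_mem hb, ?_⟩
    have hc := rigid_commute hfaith hUW ha hb
    rw [← hc] at h
    simpa using inv_mem h

lemma finite_proj (hfaith : ∀ g : G, (∀ x : X, op g • x = x) → g = 1) (H : Subgroup G) (U : Set X)
    (g : G) (hg : g ∈ H) (hUg : Disjoint U ((fun x => op g • x) '' U))
    (hN : ∃ N : ℕ, ∀ t : Fin N → rigidStabilizer G U, ∃ i j, i ≠ j ∧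
      TRel (rigidStabilizer G U) g H ((t i : G) * (t j : G)⁻¹)) :
    ((fun x : G => (x : G ⧸ projSub hfaith H U _ hUg)) '' (rigidStabilizer G U : Set G)).Finite := by
  refine finite_image (rigidStabilizer G U) g H _ ?_ hN
  have key : ∀ γ ∈ rigidStabilizer G U, γ⁻¹ * g * γ ∈ H → γ ∈ projSub hfaith H U _ hUg := by
    intro γ hγ h
    refine ⟨hγ, g⁻¹ * γ⁻¹ * g, rigid_conj (inv_mem hγ), ?_⟩
    have := mul_mem (inv_mem hg) h
    simpa [mul_assoc] using this
  rintro c hc ⟨δ, h1, h2⟩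
  have := mul_mem (key _ (mul_mem hc δ.2) h2) (inv_mem (key _ δ.2 h1))
  simpa using this

lemma pigeon {A : Type*} (φ : G → A) (Γ : Set G) (hfin : (φ '' Γ).Finite) (R : ℕ → Set G)
    (hR : ∀ n, R n ⊆ Γ) : ∃ i j k, i ≠ j ∧ i ≠ k ∧ j ≠ k ∧ φ '' R i = φ '' R j ∧
      φ '' R i = φ '' R k := by
  have hf : (𝒫 (φ '' Γ)).Finite := hfin.finite_subsets
  have : Finite (𝒫 (φ '' Γ)) := hf
  obtain ⟨y, hy⟩ := Finite.exists_infinite_fiber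
    (fun n : ℕ => (⟨φ '' R n, Set.image_mono (hR n)⟩ : 𝒫 (φ '' Γ)))
  rw [Set.infinite_coe_iff] at hy
  obtain ⟨s, hs, hcard⟩ := hy.exists_subset_card_eq 3
  obtain ⟨i, j, k, hij, hik, hjk, rfl⟩ := Finset.card_eq_three.1 hcard
  have hi : φ '' R i = y := congrArg Subtype.val (hs (a := i) (by simp))
  have hj : φ '' R j = y := congrArg Subtype.val (hs (a := j) (by simp))
  have hk : φ '' R k = y := congrArg Subtype.val (hs (a := k) (by simp))
  exact ⟨i, j, k, hij, hik, hjk, hi.trans hj.symm, hi.trans hk.symm⟩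

lemma lemmaB (hfaith : ∀ g : G, (∀ x : X, op g • x = x) → g = 1) (H : Subgroup G) (U : Set X)
    (hN : ∀ g ∈ H, ∃ N : ℕ, ∀ t : Fin N → rigidStabilizer G U, ∃ i j, i ≠ j ∧
      TRel (rigidStabilizer G U) g H ((t i : G) * (t j : G)⁻¹))
    (V : ℕ → Set X) (hVU : ∀ n, V n ⊆ U)
    (g₁ g₂ : G) (hg₁ : g₁ ∈ H) (hg₂ : g₂ ∈ H)
    (hU₁ : Disjoint U ((fun x => op g₁ • x) '' U))
    (hU₂ : Disjoint U ((fun x => op g₂ • x) '' U)) :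
    ∃ i j k, i ≠ j ∧ i ≠ k ∧ j ≠ k ∧ ∀ x ∈ rigidStabilizer G (V i), ∀ y ∈ rigidStabilizer G (V i),
      ∃ r ∈ rigidStabilizer G (V j ∪ (fun x => op g₁ • x) '' U),
      ∃ s ∈ rigidStabilizer G (V k ∪ (fun x => op g₂ • x) '' U), r * x ∈ H ∧ s * y ∈ H := by
  have h1 := finite_proj hfaith H U g₁ hg₁ hU₁ (hN _ hg₁)
  have h2 := finite_proj hfaith H U g₂ hg₂ hU₂ (hN _ hg₂)
  set P₁ := projSub hfaith H U _ hU₁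
  set P₂ := projSub hfaith H U _ hU₂
  have hfin : ((fun x : G => ((x : G ⧸ P₁), (x : G ⧸ P₂))) '' (rigidStabilizer G U : Set G)).Finite := by
    refine (h1.prod h2).subset ?_
    rintro _ ⟨x, hx, rfl⟩
    exact ⟨⟨x, hx, rfl⟩, ⟨x, hx, rfl⟩⟩
  obtain ⟨i, j, k, hij, hik, hjk, ej, ek⟩ := pigeon _ _ hfin
    (fun n => (rigidStabilizer G (V n) : Set G)) (fun n => rigid_mono (hVU n))
  refine ⟨i, j, k, hij, hik, hjk, fun x hx y hy => ?_⟩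
  have hxj : ∃ x' ∈ rigidStabilizer G (V j), x' * x ∈ P₁ := by
    have hm : ((x : G ⧸ P₁), (x : G ⧸ P₂)) ∈
        (fun x : G => ((x : G ⧸ P₁), (x : G ⧸ P₂))) '' (rigidStabilizer G (V j) : Set G) := by
      rw [← ej]; exact ⟨x, hx, rfl⟩
    obtain ⟨z, hz, he⟩ := hm
    exact ⟨z⁻¹, inv_mem hz, QuotientGroup.eq.1 (Prod.ext_iff.1 he).1⟩
  have hyk : ∃ y' ∈ rigidStabilizer G (V k), y' * y ∈ P₂ := by
    have hm : ((y : G ⧸ P₁), (y : G ⧸ P₂)) ∈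
        (fun x : G => ((x : G ⧸ P₁), (x : G ⧸ P₂))) '' (rigidStabilizer G (V k) : Set G) := by
      rw [← ek]; exact ⟨y, hy, rfl⟩
    obtain ⟨z, hz, he⟩ := hm
    exact ⟨z⁻¹, inv_mem hz, QuotientGroup.eq.1 (Prod.ext_iff.1 he).2⟩
  obtain ⟨x', hx', -, b, hb, hbx⟩ := hxj
  obtain ⟨y', hy', -, c, hc, hcy⟩ := hyk
  refine ⟨b * x', mul_mem (rigid_mono Set.subset_union_right hb)
    (rigid_mono Set.subset_union_left hx'), c * y', mul_mem (rigid_mono Set.subset_union_right hc)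
    (rigid_mono Set.subset_union_left hy'), ?_, ?_⟩
  · rwa [mul_assoc]
  · rwa [mul_assoc]

lemma comm_calc {r s x y : G} (hrx : r * x = x * r) (hry : r * y = y * r) (hsx : s * x = x * s)
    (hsy : s * y = y * s) : ⁅r * x, s * y⁆ = ⁅r, s⁆ * ⁅x, y⁆ := by
  have c1 : Commute r x := hrx
  have c2 : Commute r y := hry
  have c3 : Commute s x := hsx
  have c4 : Commute s y := hsy
  simp only [commutatorElement_def, mul_inv_rev]
  have e1 : x * s = s * x := hsx.symm
  have e2 : x⁻¹ * r⁻¹ = r⁻¹ * x⁻¹ := (c1.inv_inv).eq.symm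
  have e3 : y⁻¹ * s⁻¹ = s⁻¹ * y⁻¹ := (c4.inv_inv).eq.symm
  have e4 : x * y * r⁻¹ = r⁻¹ * (x * y) := ((c1.mul_right c2).inv_left).eq.symm
  have e5 : (x * y * x⁻¹) * s⁻¹ = s⁻¹ * (x * y * x⁻¹) :=
    (((c3.mul_right c4).mul_right c3.inv_right).inv_left).eq.symm
  calc r * x * (s * y) * (x⁻¹ * r⁻¹) * (y⁻¹ * s⁻¹)
      = r * (x * s) * y * (x⁻¹ * r⁻¹) * (y⁻¹ * s⁻¹) := by group
    _ = r * s * (x * y * r⁻¹) * x⁻¹ * (s⁻¹ * y⁻¹) := by rw [e1, e2, e3]; group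
    _ = r * s * r⁻¹ * ((x * y * x⁻¹) * s⁻¹) * y⁻¹ := by rw [e4]; group
    _ = r * s * r⁻¹ * s⁻¹ * (x * y * x⁻¹ * y⁻¹) := by rw [e5]; group

lemma exists_sep [TopologicalSpace X] [T2Space X]
    (hcont : ∀ g : G, Continuous fun x : X => op g • x) (x : X) (g h : G)
    (hne : op g • x ≠ op h • x) : ∃ O : Set X, IsOpen O ∧ x ∈ O ∧ ∀ U ⊆ O,
      Disjoint ((fun x => op g • x) '' U) ((fun x => op h • x) '' U) := by
  obtain ⟨A, B, hA, hB, hxA, hxB, hAB⟩ := t2_separation hne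
  refine ⟨(fun x => op g • x) ⁻¹' A ∩ (fun x => op h • x) ⁻¹' B,
    (hA.preimage (hcont g)).inter (hB.preimage (hcont h)), ⟨hxA, hxB⟩, fun U hU => ?_⟩
  refine hAB.mono ?_ ?_
  · rintro _ ⟨y, hy, rfl⟩; exact (hU hy).1
  · rintro _ ⟨y, hy, rfl⟩; exact (hU hy).2

/-- either `U` has an isolated point, or infinitely many disjoint open subsets -/
lemma exists_disjoint_seq [TopologicalSpace X] [T2Space X] (U : Set X) (hU : IsOpen U)
    (hne : U.Nonempty) : (∃ p, IsOpen ({p} : Set X)) ∨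
      ∃ V : ℕ → Set X, (∀ n, IsOpen (V n)) ∧ (∀ n, (V n).Nonempty) ∧ (∀ n, V n ⊆ U) ∧
        Pairwise (Function.onFun Disjoint V) := by
  by_cases hfin : Finite U
  · left
    obtain ⟨p, hp⟩ := hne
    refine ⟨p, ?_⟩
    have := hU.isOpenMap_subtype_val {(⟨p, hp⟩ : U)} (isOpen_discrete _)
    simpa using this
  · right
    have : Infinite U := not_finite_iff_infinite.1 hfin
    obtain ⟨V, h1, h2, h3⟩ := exists_seq_infinite_isOpen_pairwise_disjoint U
    refine ⟨fun n => Subtype.val '' V n, fun n => hU.isOpenMap_subtype_val _ (h2 n),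
      fun n => (h1 n).nonempty.image _, fun n => by rintro _ ⟨y, -, rfl⟩; exact y.2, ?_⟩
    intro i j hij
    exact (Set.disjoint_image_iff Subtype.val_injective).2 (h3 hij)

lemma deterministic [TopologicalSpace X] [T2Space X]
    (hcont : ∀ g : G, Continuous fun x : X => op g • x)
    (hfaith : ∀ g : G, (∀ x : X, op g • x = x) → g = 1)
    (𝓑 : Set (Set X)) (h𝓑 : TopologicalSpace.IsTopologicalBasis 𝓑)
    (H : Subgroup G) (hH : H ≠ ⊥)
    (hN : ∀ U ∈ 𝓑, ∀ g ∈ H, ∃ N : ℕ, ∀ t : Fin N → rigidStabilizer G U, ∃ i j, i ≠ j ∧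
      TRel (rigidStabilizer G U) g H ((t i : G) * (t j : G)⁻¹)) :
    ∃ U : Set X, IsOpen U ∧ U.Nonempty ∧ ⁅rigidStabilizer G U, rigidStabilizer G U⁆ ≤ H := by
  by_cases hiso : ∃ p, IsOpen ({p} : Set X)
  · obtain ⟨p, hp⟩ := hiso
    refine ⟨{p}, hp, Set.singleton_nonempty p, ?_⟩
    have h1 : ∀ g ∈ rigidStabilizer G ({p} : Set X), g = 1 := by
      intro g hg
      apply hfaith
      intro x
      by_cases hx : x = p
      · have := rigid_maps hg (show x ∈ ({p} : Set X) from hx)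
        rw [Set.mem_singleton_iff] at this
        rw [this, hx]
      · exact hg x hx
    rw [Subgroup.commutator_le]
    intro a ha b hb
    rw [h1 a ha, h1 b hb]
    simp [one_mem]
  have hseq := fun U hU hne => (exists_disjoint_seq (X := X) U hU hne).resolve_left hiso
  by_cases h3 : ∃ x : X, ∃ g₁ ∈ H, ∃ g₂ ∈ H, op g₁ • x ≠ x ∧ op g₂ • x ≠ x ∧ op g₁ • x ≠ op g₂ • x
  · obtain ⟨x, g₁, hg₁, g₂, hg₂, n1, n2, n12⟩ := h3
    obtain ⟨O₁, hO₁, hx₁, d₁⟩ := exists_sep hcont x 1 g₁ (by simpa using n1.symm)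
    obtain ⟨O₂, hO₂, hx₂, d₂⟩ := exists_sep hcont x 1 g₂ (by simpa using n2.symm)
    obtain ⟨O₃, hO₃, hx₃, d₃⟩ := exists_sep hcont x g₁ g₂ n12
    obtain ⟨U, hU𝓑, hxU, hUO⟩ := h𝓑.exists_subset_of_mem_open (a := x) (u := O₁ ∩ O₂ ∩ O₃)
      ⟨⟨hx₁, hx₂⟩, hx₃⟩ ((hO₁.inter hO₂).inter hO₃)
    have D₁ := d₁ U (fun y hy => (hUO hy).1.1)
    have D₂ := d₂ U (fun y hy => (hUO hy).1.2)
    have D₃ := d₃ U (fun y hy => (hUO hy).2)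
    simp only [op_one, one_smul, Set.image_id'] at D₁ D₂
    obtain ⟨V, hVo, hVn, hVU, hVd⟩ := hseq U (h𝓑.isOpen hU𝓑) ⟨x, hxU⟩
    obtain ⟨i, j, k, hij, hik, hjk, key⟩ := lemmaB hfaith H U (hN U hU𝓑) V hVU g₁ g₂ hg₁ hg₂ D₁ D₂
    refine ⟨V i, hVo i, hVn i, ?_⟩
    rw [Subgroup.commutator_le]
    intro a ha b hb
    obtain ⟨r, hr, s, hs, hra, hsb⟩ := key a ha b hb
    have A₁ : Disjoint (V j ∪ (fun x => op g₁ • x) '' U) (V i) :=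
      Set.disjoint_union_left.2 ⟨hVd hij.symm, (D₁.mono_left (hVU i)).symm⟩
    have A₂ : Disjoint (V k ∪ (fun x => op g₂ • x) '' U) (V i) :=
      Set.disjoint_union_left.2 ⟨hVd hik.symm, (D₂.mono_left (hVU i)).symm⟩
    have A₃ : Disjoint (V j ∪ (fun x => op g₁ • x) '' U) (V k ∪ (fun x => op g₂ • x) '' U) :=
      Set.disjoint_union_left.2 ⟨Set.disjoint_union_right.2 ⟨hVd hjk, D₂.mono_left (hVU j)⟩,
        Set.disjoint_union_right.2 ⟨(D₁.mono_left (hVU k)).symm, D₃⟩⟩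
    have e := comm_calc (rigid_commute hfaith A₁ hr ha) (rigid_commute hfaith A₁ hr hb)
      (rigid_commute hfaith A₂ hs ha) (rigid_commute hfaith A₂ hs hb)
    rw [commutatorElement_eq_one_iff_mul_comm.2 (rigid_commute hfaith A₃ hr hs), one_mul] at e
    rw [← e, commutatorElement_def]
    exact mul_mem (mul_mem (mul_mem hra hsb) (inv_mem hra)) (inv_mem hsb)
  · push Not at h3
    have hsq : ∀ h ∈ H, h * h = 1 := by
      intro h hh
      apply hfaith
      intro x
      rw [op_mul, mul_smul]
      by_cases hx : op h • x = x
      · rw [hx, hx]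
      · by_contra hx2
        have := h3 x h hh (h * h) (mul_mem hh hh) hx (by rwa [op_mul, mul_smul])
        rw [op_mul, mul_smul] at this
        exact hx (MulAction.injective (op h) this).symm
    have hcomm : ∀ a ∈ H, ∀ b ∈ H, a * b = b * a := by
      intro a ha b hb
      have h1 := hsq _ (mul_mem ha hb)
      have ia : a⁻¹ = a := inv_eq_of_mul_eq_one_left (hsq a ha)
      have ib : b⁻¹ = b := inv_eq_of_mul_eq_one_left (hsq b hb)
      have h2 : (a * b)⁻¹ = a * b := inv_eq_of_mul_eq_one_left h1
      rw [← h2, mul_inv_rev, ia, ib]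
    obtain ⟨g, hg, hg1⟩ := Subgroup.ne_bot_iff_exists_ne_one.1 hH |>.elim
      (fun g hg => (⟨g.1, g.2, fun h => hg (Subtype.ext h)⟩ : ∃ g, g ∈ H ∧ g ≠ 1))
    obtain ⟨x, hx⟩ : ∃ x : X, op g • x ≠ x := by
      by_contra hcon
      push Not at hcon
      exact hg1 (hfaith g hcon)
    obtain ⟨O₁, hO₁, hx₁, d₁⟩ := exists_sep hcont x 1 g (by simpa using hx.symm)
    obtain ⟨U, hU𝓑, hxU, hUO⟩ := h𝓑.exists_subset_of_mem_open hx₁ hO₁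
    have D₁ := d₁ U hUO
    simp only [op_one, one_smul, Set.image_id'] at D₁
    obtain ⟨V, hVo, hVn, hVU, hVd⟩ := hseq U (h𝓑.isOpen hU𝓑) ⟨x, hxU⟩
    obtain ⟨i, j, k, hij, hik, hjk, key⟩ := lemmaB hfaith H U (hN U hU𝓑) V hVU g g hg hg D₁ D₁
    refine ⟨V i, hVo i, hVn i, ?_⟩
    rw [Subgroup.commutator_le]
    intro a ha b hb
    obtain ⟨r, hr, s, hs, hra, hsb⟩ := key a ha b hb
    have A₁ : Disjoint (V j ∪ (fun x => op g • x) '' U) (V i) :=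
      Set.disjoint_union_left.2 ⟨hVd hij.symm, (D₁.mono_left (hVU i)).symm⟩
    have A₂ : Disjoint (V k ∪ (fun x => op g • x) '' U) (V i) :=
      Set.disjoint_union_left.2 ⟨hVd hik.symm, (D₁.mono_left (hVU i)).symm⟩
    have e := comm_calc (rigid_commute hfaith A₁ hr ha) (rigid_commute hfaith A₁ hr hb)
      (rigid_commute hfaith A₂ hs ha) (rigid_commute hfaith A₂ hs hb)
    rw [commutatorElement_eq_one_iff_mul_comm.2 (hcomm _ hra _ hsb)] at e
    have e' : ⁅a, b⁆ = ⁅r, s⁆⁻¹ := eq_inv_of_mul_eq_one_right e.symm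
    have hab : ⁅a, b⁆ ∈ rigidStabilizer G (V i) := by
      rw [commutatorElement_def]
      exact mul_mem (mul_mem (mul_mem ha hb) (inv_mem ha)) (inv_mem hb)
    have hrs : ⁅a, b⁆ ∈ rigidStabilizer G
        ((V j ∪ (fun x => op g • x) '' U) ∪ (V k ∪ (fun x => op g • x) '' U)) := by
      rw [e', commutatorElement_def]
      have hr' := rigid_mono (G := G) (Set.subset_union_left (t := V k ∪ (fun x => op g • x) '' U)) hr
      have hs' := rigid_mono (G := G) (Set.subset_union_right (s := V j ∪ (fun x => op g • x) '' U)) hs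
      exact inv_mem (mul_mem (mul_mem (mul_mem hr' hs') (inv_mem hr')) (inv_mem hs'))
    rw [rigid_eq_one hfaith (Set.disjoint_union_left.2 ⟨A₁, A₂⟩) hrs hab]
    exact one_mem _

lemma ae_ne_bot [Countable G] (μ : Measure (Subgroup G)) [IsProbabilityMeasure μ]
    (herg : ∀ A : Set (Subgroup G), MeasurableSet A →
      (∀ g : G, (fun H : Subgroup G => conjSubgroup g H) ⁻¹' A = A) → μ A = 0 ∨ μ A = 1)
    (hne : μ ≠ Measure.dirac (⊥ : Subgroup G)) : ∀ᵐ H ∂μ, H ≠ ⊥ := by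
  have hm : MeasurableSet ({⊥} : Set (Subgroup G)) := by
    have : ({⊥} : Set (Subgroup G)) = ⋂ g : G, ⋂ (_ : g ≠ 1), {H : Subgroup G | g ∈ H}ᶜ := by
      ext H
      simp only [Set.mem_singleton_iff, Set.mem_iInter, Set.mem_compl_iff, Set.mem_ofPred_eq,
        Subgroup.eq_bot_iff_forall]
      exact forall_congr' fun g => by tauto
    rw [this]
    exact MeasurableSet.iInter fun g => MeasurableSet.iInter fun _ => (measurableSet_memSub g).compl
  have hi : ∀ g : G, (fun H : Subgroup G => conjSubgroup g H) ⁻¹' {⊥} = {⊥} := by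
    intro g
    ext H
    simp only [Set.mem_preimage, Set.mem_singleton_iff, conjSubgroup]
    exact Subgroup.map_eq_bot_iff_of_injective H (MulAut.conj g⁻¹).injective
  rcases herg _ hm hi with h | h
  · rw [ae_iff]
    simpa using h
  · exfalso
    apply hne
    have hae : ∀ᵐ H ∂μ, H = ⊥ := (mem_ae_iff_prob_eq_one hm).2 h
    ext s hs
    rw [Measure.dirac_apply' _ hs]
    by_cases hb : (⊥ : Subgroup G) ∈ s
    · rw [Set.indicator_of_mem hb, Pi.one_apply, ← mem_ae_iff_prob_eq_one hs]
      filter_upwards [hae] with H hH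
      rw [hH]; exact hb
    · rw [Set.indicator_of_notMem hb, measure_eq_zero_iff_ae_notMem]
      filter_upwards [hae] with H hH
      rw [hH]; exact hb

end Helpers

/-- **Double commutator lemma for IRSs, part (i)** (Theorem 1.2(i)).
Let `G` be a countable group acting faithfully on the right by homeomorphisms on a
second countable Hausdorff space `X` (the right action is encoded as a left action of
`Gᵐᵒᵖ`, so `x·g = op g • x`), and let `μ` be an ergodic invariant random subgroup of `G`
which is not the Dirac mass at the trivial subgroup.  Then for `μ`-a.e. subgroup `H`
there is a nonempty open set `U ⊆ X` with `[R_G(U), R_G(U)] ≤ H`. -/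
theorem irs_double_commutator_part_i
    {G X : Type*} [Group G] [Countable G] [TopologicalSpace X]
    [SecondCountableTopology X] [T2Space X] [MulAction Gᵐᵒᵖ X]
    (hcont : ∀ g : G, Continuous fun x : X => op g • x)
    (hfaith : ∀ g : G, (∀ x : X, op g • x = x) → g = 1)
    (μ : Measure (Subgroup G)) [IsProbabilityMeasure μ]
    (hinv : ∀ g : G, ∀ A : Set (Subgroup G), MeasurableSet A →
      μ ((fun H : Subgroup G => conjSubgroup g H) ⁻¹' A) = μ A)
    (herg : ∀ A : Set (Subgroup G), MeasurableSet A →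
      (∀ g : G, (fun H : Subgroup G => conjSubgroup g H) ⁻¹' A = A) → μ A = 0 ∨ μ A = 1)
    (hne : μ ≠ Measure.dirac (⊥ : Subgroup G)) :
    ∀ᵐ H ∂μ, ∃ U : Set X, IsOpen U ∧ U.Nonempty ∧
      ⁅rigidStabilizer G U, rigidStabilizer G U⁆ ≤ H := by
  obtain ⟨𝓑, hc, -, h𝓑⟩ := TopologicalSpace.exists_countable_basis X
  have h1 : ∀ᵐ H ∂μ, ∀ U ∈ 𝓑, ∀ g : G, g ∈ H → ∃ N : ℕ, ∀ t : Fin N → rigidStabilizer G U,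
      ∃ i j, i ≠ j ∧ TRel (rigidStabilizer G U) g H ((t i : G) * (t j : G)⁻¹) := by
    rw [ae_ball_iff hc]
    intro U _
    rw [ae_all_iff]
    exact fun g => lemmaA μ hinv _ g
  filter_upwards [h1, ae_ne_bot μ herg hne] with H hH hb
  exact deterministic hcont hfaith 𝓑 h𝓑 H hb hH
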